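/- Let f = (f11,f12,f22) be a symmetric 2-tensor field with C² components compactly supported in the open unit disk, and assume u1 = u2 (i.e. u1 = u2 = 1/√2). Then for every x ∈ ℝ², f22(x) = (1/(4·u2))·D_u D_v X_{e2}(Lf + Tf)(x) + (1/(2·u1))·D_u D_v X_{-e1}(Mf)(x), where X_{-e1} denotes the divergent beam transform in the direction -e1. -/

import Mathlib

open MeasureTheory

noncomputable section

/-- Rotation of a vector by 90 degrees: `w⊥ = (-w2, w1)`. -/
def perp (w : ℝ × ℝ) : ℝ × ℝ := (-w.2, w.1)

/-- Divergent beam transform `X_w h (x) = ∫_0^∞ h(x + t w) dt`. -/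
def Xray (w : ℝ × ℝ) (h : ℝ × ℝ → ℝ) (x : ℝ × ℝ) : ℝ :=
  ∫ t in Set.Ioi (0:ℝ), h (x + t • w)

/-- First moment divergent beam transform `X¹_w h (x) = ∫_0^∞ t·h(x + t w) dt`. -/
def Xray1 (w : ℝ × ℝ) (h : ℝ × ℝ → ℝ) (x : ℝ × ℝ) : ℝ :=
  ∫ t in Set.Ioi (0:ℝ), t * h (x + t • w)

/-- Directional derivative `D_w h = w1 ∂h/∂x1 + w2 ∂h/∂x2`. -/
def Dw (w : ℝ × ℝ) (h : ℝ × ℝ → ℝ) (x : ℝ × ℝ) : ℝ :=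
  fderiv ℝ h x w

/-- Partial derivative in the first coordinate. -/
def pdx (h : ℝ × ℝ → ℝ) : ℝ × ℝ → ℝ := Dw (1, 0) h

/-- Partial derivative in the second coordinate. -/
def pdy (h : ℝ × ℝ → ℝ) : ℝ × ℝ → ℝ := Dw (0, 1) h

/-- The open unit disk in ℝ². -/
def unitDisk : Set (ℝ × ℝ) := {x | x.1 ^ 2 + x.2 ^ 2 < 1}

/-- `⟨f, w²⟩ = f11 w1² + 2 f12 w1 w2 + f22 w2²`. -/
def proj2 (f11 f12 f22 : ℝ × ℝ → ℝ) (w : ℝ × ℝ) (x : ℝ × ℝ) : ℝ :=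
  f11 x * w.1 ^ 2 + 2 * f12 x * w.1 * w.2 + f22 x * w.2 ^ 2

/-- `⟨f, w ⊙ w⊥⟩ = -f11 w1 w2 + f12 (w1² - w2²) + f22 w1 w2`. -/
def projMix (f11 f12 f22 : ℝ × ℝ → ℝ) (w : ℝ × ℝ) (x : ℝ × ℝ) : ℝ :=
  -(f11 x) * w.1 * w.2 + f12 x * (w.1 ^ 2 - w.2 ^ 2) + f22 x * w.1 * w.2

/-- V-line transform of a scalar function. -/
def Vlt (u v : ℝ × ℝ) (h : ℝ × ℝ → ℝ) (x : ℝ × ℝ) : ℝ := Xray u h x + Xray v h x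

/-- Longitudinal V-line transform. -/
def Lf (u v : ℝ × ℝ) (f11 f12 f22 : ℝ × ℝ → ℝ) (x : ℝ × ℝ) : ℝ :=
  Xray u (proj2 f11 f12 f22 u) x + Xray v (proj2 f11 f12 f22 v) x

/-- Transverse V-line transform. -/
def Tf (u v : ℝ × ℝ) (f11 f12 f22 : ℝ × ℝ → ℝ) (x : ℝ × ℝ) : ℝ :=
  Xray u (proj2 f11 f12 f22 (perp u)) x + Xray v (proj2 f11 f12 f22 (perp v)) x

/-- Mixed V-line transform. -/
def Mf (u v : ℝ × ℝ) (f11 f12 f22 : ℝ × ℝ → ℝ) (x : ℝ × ℝ) : ℝ :=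
  Xray u (projMix f11 f12 f22 u) x + Xray v (projMix f11 f12 f22 v) x

/-- First moment longitudinal V-line transform. -/
def L1f (u v : ℝ × ℝ) (f11 f12 f22 : ℝ × ℝ → ℝ) (x : ℝ × ℝ) : ℝ :=
  Xray1 u (proj2 f11 f12 f22 u) x + Xray1 v (proj2 f11 f12 f22 v) x

/-- The function `k` vanishes on a half-plane `{p | C ≤ l p}`. -/
def VanishesBeyond {E : Type*} [Zero E] (l : ℝ × ℝ →L[ℝ] ℝ) (k : ℝ × ℝ → E) : Prop :=
  ∃ C : ℝ, ∀ p, C ≤ l p → k p = 0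

section RayIntegral

variable {E : Type*} [NormedAddCommGroup E]
  {l : ℝ × ℝ →L[ℝ] ℝ} {k : ℝ × ℝ → E} {w : ℝ × ℝ}

theorem VanishesBeyond.of_hasCompactSupport (hk : HasCompactSupport k) :
    VanishesBeyond l k := by
  obtain ⟨C, hC⟩ := hk.isCompact.bddAbove_image l.continuous.continuousOn
  refine ⟨C + 1, fun p hp => ?_⟩
  by_contra h
  have := hC (Set.mem_image_of_mem l (subset_tsupport k h))
  linarith

theorem VanishesBeyond.add {k' : ℝ × ℝ → E} (hk : VanishesBeyond l k)
    (hk' : VanishesBeyond l k') : VanishesBeyond l (fun p => k p + k' p) := by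
  obtain ⟨C, hC⟩ := hk
  obtain ⟨C', hC'⟩ := hk'
  refine ⟨max C C', fun p hp => ?_⟩
  simp [hC p (le_trans (le_max_left _ _) hp), hC' p (le_trans (le_max_right _ _) hp)]

theorem exists_eventually_ray_le (C : ℝ) (hw : 0 < l w) (x₀ : ℝ × ℝ) :
    ∃ T, 0 ≤ T ∧ ∀ᶠ x in nhds x₀, C ≤ l x + T * l w := by
  refine ⟨|C + 1 - l x₀| / l w, by positivity, ?_⟩
  filter_upwards [l.continuous.continuousAt.eventually_const_lt
    (show l x₀ - 1 < l x₀ by linarith)] with x hx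
  rw [div_mul_cancel₀ _ hw.ne']
  linarith [le_abs_self (C + 1 - l x₀)]

theorem integrableOn_Ioi_ray (hk : Continuous k) (hl : VanishesBeyond l k) (hw : 0 < l w)
    (x : ℝ × ℝ) : IntegrableOn (fun t : ℝ => k (x + t • w)) (Set.Ioi 0) := by
  obtain ⟨C, hC⟩ := hl
  obtain ⟨T, hT, hev⟩ := exists_eventually_ray_le C hw x
  have hc : Continuous fun t : ℝ => k (x + t • w) := by fun_prop
  refine (hc.integrableOn_Icc (a := 0) (b := T)).of_forall_sdiff_eq_zero measurableSet_Ioi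
    fun t ht => hC _ ?_
  have : T < t := by
    by_contra h
    exact ht.2 ⟨le_of_lt ht.1, not_lt.mp h⟩
  have := hev.self_of_nhds
  rw [map_add, map_smul, smul_eq_mul]
  nlinarith

variable [NormedSpace ℝ E]

theorem VanishesBeyond.fderiv (hk : VanishesBeyond l k) : VanishesBeyond l (fderiv ℝ k) := by
  obtain ⟨C, hC⟩ := hk
  refine ⟨C + 1, fun p hp => ?_⟩
  have hev : k =ᶠ[nhds p] fun _ => 0 := by
    filter_upwards [l.continuous.continuousAt.eventually_const_lt
      (show C < l p by linarith)] with q hq using hC q hq.le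
  rw [hev.fderiv_eq]
  simp

theorem setIntegral_Ioi_ray_eq_intervalIntegral {C T : ℝ} (hC : ∀ p, C ≤ l p → k p = 0)
    (hw : 0 ≤ l w) (hT : 0 ≤ T) {x : ℝ × ℝ} (hx : C ≤ l x + T * l w) :
    ∫ t in Set.Ioi (0 : ℝ), k (x + t • w) = ∫ t in (0 : ℝ)..T, k (x + t • w) := by
  rw [intervalIntegral.integral_of_le hT]
  refine setIntegral_eq_of_subset_of_forall_sdiff_eq_zero measurableSet_Ioi
    Set.Ioc_subset_Ioi_self fun t ht => hC _ ?_
  have : T < t := by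
    by_contra h
    exact ht.2 ⟨ht.1, not_lt.mp h⟩
  rw [map_add, map_smul, smul_eq_mul]
  nlinarith

theorem continuous_setIntegral_Ioi_ray (hk : Continuous k) (hl : VanishesBeyond l k)
    (hw : 0 < l w) : Continuous fun x => ∫ t in Set.Ioi (0 : ℝ), k (x + t • w) := by
  obtain ⟨C, hC⟩ := hl
  refine continuous_iff_continuousAt.mpr fun x₀ => ?_
  obtain ⟨T, hT, hev⟩ := exists_eventually_ray_le C hw x₀
  have hc : Continuous fun x => ∫ t in (0 : ℝ)..T, k (x + t • w) :=
    intervalIntegral.continuous_parametric_intervalIntegral_of_continuous' (by fun_prop) 0 T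
  refine hc.continuousAt.congr ?_
  filter_upwards [hev] with x hx
  exact (setIntegral_Ioi_ray_eq_intervalIntegral hC hw.le hT hx).symm

theorem hasFDerivAt_setIntegral_Ioi_ray (hk : ContDiff ℝ 1 k) (hl : VanishesBeyond l k)
    (hw : 0 < l w) (x₀ : ℝ × ℝ) :
    HasFDerivAt (fun x => ∫ t in Set.Ioi (0 : ℝ), k (x + t • w))
      (∫ t in Set.Ioi (0 : ℝ), fderiv ℝ k (x₀ + t • w)) x₀ := by
  obtain ⟨C', hC'⟩ := hl.fderiv
  obtain ⟨C, hC⟩ := hl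
  obtain ⟨T, hT, hev⟩ := exists_eventually_ray_le (max C C') hw x₀
  rw [setIntegral_Ioi_ray_eq_intervalIntegral hC' hw.le hT
    (le_trans (le_max_right _ _) hev.self_of_nhds)]
  have hkc : Continuous k := hk.continuous
  have hdc : Continuous (fderiv ℝ k) := hk.continuous_fderiv one_ne_zero
  have hcomp : IsCompact (Metric.closedBall x₀ 1 ×ˢ Set.Icc (0 : ℝ) T) :=
    (isCompact_closedBall x₀ 1).prod isCompact_Icc
  obtain ⟨B, hB⟩ := hcomp.exists_bound_of_continuousOn
    (f := fun p : (ℝ × ℝ) × ℝ => fderiv ℝ k (p.1 + p.2 • w))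
    (Continuous.continuousOn (by fun_prop))
  have main : HasFDerivAt (fun x => ∫ t in (0 : ℝ)..T, k (x + t • w))
      (∫ t in (0 : ℝ)..T, fderiv ℝ k (x₀ + t • w)) x₀ := by
    refine intervalIntegral.hasFDerivAt_integral_of_dominated_of_fderiv_le
      (F := fun x t => k (x + t • w)) (F' := fun x t => fderiv ℝ k (x + t • w))
      (bound := fun _ => B) (Metric.closedBall_mem_nhds x₀ one_pos) ?_ ?_ ?_ ?_ ?_ ?_
    · exact Filter.Eventually.of_forall fun x =>
        Continuous.aestronglyMeasurable (by fun_prop)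
    · exact Continuous.intervalIntegrable (by fun_prop) _ _
    · exact Continuous.aestronglyMeasurable (by fun_prop)
    · refine Filter.Eventually.of_forall fun t ht x hx => hB (x, t) ⟨hx, ?_⟩
      rw [Set.uIoc_of_le hT] at ht
      exact Set.Ioc_subset_Icc_self ht
    · exact intervalIntegrable_const
    · refine Filter.Eventually.of_forall fun t _ x _ => ?_
      exact (hasFDerivAt_comp_add_right (t • w)).mpr
        (hk.differentiable one_ne_zero (x + t • w)).hasFDerivAt
  refine main.congr_of_eventuallyEq ?_
  filter_upwards [hev] with x hx
  exact setIntegral_Ioi_ray_eq_intervalIntegral hC hw.le hT (le_trans (le_max_left _ _) hx)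

end RayIntegral

section Xray

variable {l : ℝ × ℝ →L[ℝ] ℝ} {k : ℝ × ℝ → ℝ} {w : ℝ × ℝ}

theorem VanishesBeyond.Dw (hk : VanishesBeyond l k) (d : ℝ × ℝ) : VanishesBeyond l (Dw d k) := by
  obtain ⟨C, hC⟩ := hk.fderiv
  exact ⟨C, fun p hp => by simp [_root_.Dw, hC p hp]⟩

theorem VanishesBeyond.Xray (hk : VanishesBeyond l k) (hw : 0 ≤ l w) :
    VanishesBeyond l (Xray w k) := by
  obtain ⟨C, hC⟩ := hk
  refine ⟨C, fun p hp => setIntegral_eq_zero_of_forall_eq_zero fun t ht => hC _ ?_⟩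
  rw [map_add, map_smul, smul_eq_mul]
  nlinarith [mul_nonneg (le_of_lt ht) hw]

theorem contDiff_Dw {h : ℝ × ℝ → ℝ} (hh : ContDiff ℝ 2 h) (d : ℝ × ℝ) :
    ContDiff ℝ 1 (Dw d h) :=
  (hh.fderiv_right (m := 1) (by norm_num)).clm_apply contDiff_const

theorem contDiff_Xray (hk : ContDiff ℝ 1 k) (hl : VanishesBeyond l k) (hw : 0 < l w) :
    ContDiff ℝ 1 (Xray w k) :=
  contDiff_one_iff_hasFDerivAt.mpr ⟨_,
    continuous_setIntegral_Ioi_ray (hk.continuous_fderiv one_ne_zero) hl.fderiv hw,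
    hasFDerivAt_setIntegral_Ioi_ray hk hl hw⟩

/-- Directional derivatives commute with the divergent beam transform. -/
theorem Dw_Xray (hk : ContDiff ℝ 1 k) (hl : VanishesBeyond l k) (hw : 0 < l w) (d : ℝ × ℝ) :
    Dw d (Xray w k) = Xray w (Dw d k) := by
  funext x
  have hd := (hasFDerivAt_setIntegral_Ioi_ray hk hl hw x).fderiv
  have hi := integrableOn_Ioi_ray (hk.continuous_fderiv one_ne_zero) hl.fderiv hw x
  change fderiv ℝ (fun x => ∫ t in Set.Ioi (0 : ℝ), k (x + t • w)) x d = _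
  rw [hd, ContinuousLinearMap.integral_apply hi]
  rfl

/-- Differentiating along the ray inverts the divergent beam transform, up to sign. -/
theorem Xray_Dw_self (hk : ContDiff ℝ 1 k) (hl : VanishesBeyond l k) (hw : 0 < l w) :
    Xray w (Dw w k) = fun x => -k x := by
  funext x
  obtain ⟨C', hC'⟩ := hl.Dw w
  obtain ⟨C, hC⟩ := hl
  obtain ⟨T, hT, hev⟩ := exists_eventually_ray_le (max C C') hw x
  have hx := hev.self_of_nhds
  have hdc : Continuous (fderiv ℝ k) := hk.continuous_fderiv one_ne_zero
  have hderiv : ∀ t : ℝ, HasDerivAt (fun t : ℝ => k (x + t • w)) (Dw w k (x + t • w)) t := by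
    intro t
    have h1 : HasDerivAt (fun t : ℝ => x + t • w) w t := by
      simpa using ((hasDerivAt_id t).smul_const w).const_add x
    exact (hk.differentiable one_ne_zero (x + t • w)).hasFDerivAt.comp_hasDerivAt t h1
  change ∫ t in Set.Ioi (0 : ℝ), Dw w k (x + t • w) = _
  rw [setIntegral_Ioi_ray_eq_intervalIntegral hC' hw.le hT (le_trans (le_max_right _ _) hx),
    intervalIntegral.integral_eq_sub_of_hasDerivAt (fun t _ => hderiv t)
      (Continuous.intervalIntegrable (by unfold Dw; fun_prop) _ _),
    hC (x + T • w) (by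
      rw [map_add, map_smul, smul_eq_mul]
      exact le_trans (le_max_left _ _) hx)]
  simp

theorem Dw_Xray_self (hk : ContDiff ℝ 1 k) (hl : VanishesBeyond l k) (hw : 0 < l w) :
    Dw w (Xray w k) = fun x => -k x := by
  rw [Dw_Xray hk hl hw, Xray_Dw_self hk hl hw]

theorem Dw_fun_add {g h : ℝ × ℝ → ℝ} (hg : ContDiff ℝ 1 g) (hh : ContDiff ℝ 1 h) (d : ℝ × ℝ) :
    Dw d (fun y => g y + h y) = fun y => Dw d g y + Dw d h y := by
  funext y
  unfold Dw
  rw [fderiv_fun_add (hg.differentiable one_ne_zero y) (hh.differentiable one_ne_zero y)]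
  rfl

theorem Dw_fun_neg (h : ℝ × ℝ → ℝ) (d : ℝ × ℝ) :
    Dw d (fun y => -h y) = fun y => -Dw d h y := by
  funext y
  simp [Dw, fderiv_fun_neg]

theorem Xray_const_mul (c : ℝ) (h : ℝ × ℝ → ℝ) (w : ℝ × ℝ) :
    Xray w (fun y => c * h y) = fun y => c * Xray w h y := by
  funext y
  exact integral_const_mul c _

/-- Two directional derivatives along the branches remove both rays of a V-line transform. -/
theorem Dw_Dw_Xray_add_Xray {m : ℝ × ℝ →L[ℝ] ℝ} {u v a : ℝ × ℝ} {g h : ℝ × ℝ → ℝ}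
    (hg : ContDiff ℝ 2 g) (hh : ContDiff ℝ 2 h)
    (hgs : HasCompactSupport g) (hhs : HasCompactSupport h)
    (hmu : 0 < m u) (hmv : 0 < m v) (hlu : 0 ≤ l u) (hlv : 0 ≤ l v) (hla : 0 < l a) :
    Dw u (Dw v (Xray a (fun y => Xray u g y + Xray v h y))) =
      Xray a (fun y => -Dw v g y + -Dw u h y) := by
  have hg1 : ContDiff ℝ 1 g := hg.of_le one_le_two
  have hh1 : ContDiff ℝ 1 h := hh.of_le one_le_two
  have vg (n : ℝ × ℝ →L[ℝ] ℝ) : VanishesBeyond n g := .of_hasCompactSupport hgs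
  have vh (n : ℝ × ℝ →L[ℝ] ℝ) : VanishesBeyond n h := .of_hasCompactSupport hhs
  have cu := contDiff_Xray hg1 (vg m) hmu
  have cv := contDiff_Xray hh1 (vh m) hmv
  have cdg := contDiff_Dw hg v
  have cuv := contDiff_Xray cdg ((vg m).Dw v) hmu
  have vneg : VanishesBeyond l (fun y => -h y) := .of_hasCompactSupport hhs.neg
  rw [Dw_Xray (cu.add cv) (((vg l).Xray hlu).add ((vh l).Xray hlv)) hla,
    Dw_fun_add cu cv, Dw_Xray hg1 (vg m) hmu, Dw_Xray_self hh1 (vh m) hmv,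
    Dw_Xray (cuv.add hh1.neg) ((((vg l).Dw v).Xray hlu).add vneg) hla,
    Dw_fun_add cuv hh1.neg, Dw_Xray_self cdg ((vg m).Dw v) hmu, Dw_fun_neg]

end Xray

theorem hasCompactSupport_of_tsupport_subset_unitDisk {h : ℝ × ℝ → ℝ}
    (hs : tsupport h ⊆ unitDisk) : HasCompactSupport h := by
  refine HasCompactSupport.of_support_subset_isCompact
    (isCompact_Icc (a := ((-1, -1) : ℝ × ℝ)) (b := (1, 1))) fun p hp => ?_
  have hp' : p.1 ^ 2 + p.2 ^ 2 < 1 := hs (subset_tsupport h hp)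
  refine ⟨⟨?_, ?_⟩, ⟨?_, ?_⟩⟩ <;> dsimp only <;> nlinarith [sq_nonneg p.1, sq_nonneg p.2]

theorem stmt_10 (u1 u2 : ℝ) (hu1 : 0 < u1) (hu2 : 0 < u2) (huv : u1 ^ 2 + u2 ^ 2 = 1)
    (f11 f12 f22 : ℝ × ℝ → ℝ)
    (hf11 : ContDiff ℝ 2 f11) (hf12 : ContDiff ℝ 2 f12) (hf22 : ContDiff ℝ 2 f22)
    (hs11 : tsupport f11 ⊆ unitDisk) (hs12 : tsupport f12 ⊆ unitDisk)
    (hs22 : tsupport f22 ⊆ unitDisk)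
    (hueq : u1 = u2) :
    ∀ x : ℝ × ℝ,
      f22 x =
        (1 / (4 * u2)) *
            Dw (u1, u2) (Dw (-u1, u2) (Xray (0, 1) (fun y => Lf (u1, u2) (-u1, u2) f11 f12 f22 y + Tf (u1, u2) (-u1, u2) f11 f12 f22 y))) x +
          (1 / (2 * u1)) * Dw (u1, u2) (Dw (-u1, u2) (Xray (-1, 0) (Mf (u1, u2) (-u1, u2) f11 f12 f22))) x := by
  subst hueq
  intro x
  have hsq : u1 ^ 2 = 1 / 2 := by linarith
  have c11 := hasCompactSupport_of_tsupport_subset_unitDisk hs11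
  have c12 := hasCompactSupport_of_tsupport_subset_unitDisk hs12
  have c22 := hasCompactSupport_of_tsupport_subset_unitDisk hs22
  have hsum : ContDiff ℝ 2 (fun y => f11 y + f22 y) := hf11.add hf22
  have csum : HasCompactSupport (fun y => f11 y + f22 y) := c11.add c22
  have hdif : ContDiff ℝ 2 (fun y => (f22 y - f11 y) / 2) := (hf22.sub hf11).div_const 2
  have cdif : HasCompactSupport (fun y => (f22 y - f11 y) / 2) :=
    (c22.sub c11).comp_left (g := fun r : ℝ => r / 2) (by simp)
  have hdif' : ContDiff ℝ 2 (fun y => -((f22 y - f11 y) / 2)) := hdif.neg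
  have cdif' : HasCompactSupport (fun y => -((f22 y - f11 y) / 2)) := cdif.neg
  let m : ℝ × ℝ →L[ℝ] ℝ := ContinuousLinearMap.snd ℝ ℝ ℝ
  let l : ℝ × ℝ →L[ℝ] ℝ := ContinuousLinearMap.snd ℝ ℝ ℝ - ContinuousLinearMap.fst ℝ ℝ ℝ
  have hmu : 0 < m (u1, u1) := hu1
  have hmv : 0 < m (-u1, u1) := hu1
  have cproj (w : ℝ × ℝ) : Continuous (proj2 f11 f12 f22 w) := by
    have := hf11.continuous
    have := hf12.continuous
    have := hf22.continuous
    unfold proj2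
    fun_prop
  have vproj (w : ℝ × ℝ) : VanishesBeyond m (proj2 f11 f12 f22 w) := by
    obtain ⟨C₁, h₁⟩ := VanishesBeyond.of_hasCompactSupport (l := m) c11
    obtain ⟨C₂, h₂⟩ := VanishesBeyond.of_hasCompactSupport (l := m) c12
    obtain ⟨C₃, h₃⟩ := VanishesBeyond.of_hasCompactSupport (l := m) c22
    refine ⟨max C₁ (max C₂ C₃), fun p hp => ?_⟩
    simp only [max_le_iff] at hp
    simp [proj2, h₁ p hp.1, h₂ p hp.2.1, h₃ p hp.2.2]
  have trace_eq (w : ℝ × ℝ) (hw : 0 < m w) (hn : w.1 ^ 2 + w.2 ^ 2 = 1) (y : ℝ × ℝ) :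
      Xray w (proj2 f11 f12 f22 w) y + Xray w (proj2 f11 f12 f22 (perp w)) y =
        Xray w (fun y => f11 y + f22 y) y := by
    unfold Xray
    rw [← integral_add (integrableOn_Ioi_ray (cproj _) (vproj _) hw y)
      (integrableOn_Ioi_ray (cproj _) (vproj _) hw y)]
    congr 1
    funext t
    simp only [proj2, perp]
    linear_combination (f11 (y + t • w) + f22 (y + t • w)) * hn
  have hLT : (fun y => Lf (u1, u1) (-u1, u1) f11 f12 f22 y +
      Tf (u1, u1) (-u1, u1) f11 f12 f22 y) = fun y =>
        Xray (u1, u1) (fun y => f11 y + f22 y) y + Xray (-u1, u1) (fun y => f11 y + f22 y) y := by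
    funext y
    rw [← trace_eq _ hmu huv, ← trace_eq _ hmv (by simpa using huv)]
    simp only [Lf, Tf]
    ring
  have hM : Mf (u1, u1) (-u1, u1) f11 f12 f22 = fun y =>
      Xray (u1, u1) (fun y => (f22 y - f11 y) / 2) y +
        Xray (-u1, u1) (fun y => -((f22 y - f11 y) / 2)) y := by
    have h₁ : projMix f11 f12 f22 (u1, u1) = fun y => (f22 y - f11 y) / 2 := by
      funext y
      simp only [projMix]
      linear_combination (f22 y - f11 y) * hsq
    have h₂ : projMix f11 f12 f22 (-u1, u1) = fun y => -((f22 y - f11 y) / 2) := by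
      funext y
      simp only [projMix]
      linear_combination -(f22 y - f11 y) * hsq
    funext y
    rw [Mf, h₁, h₂]
  have hDsum : (fun y => -Dw (-u1, u1) (fun y => f11 y + f22 y) y +
      -Dw (u1, u1) (fun y => f11 y + f22 y) y) =
        fun y => (-2 * u1) * Dw (0, 1) (fun y => f11 y + f22 y) y := by
    funext y
    have : ((-u1, u1) : ℝ × ℝ) + (u1, u1) = (2 * u1) • (0, 1) := by
      ext <;> simp [two_mul]
    simp only [Dw]
    rw [← neg_add, ← map_add, this, map_smul, smul_eq_mul]
    ring
  have hDdif : (fun y => -Dw (-u1, u1) (fun y => (f22 y - f11 y) / 2) y +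
      -Dw (u1, u1) (fun y => -((f22 y - f11 y) / 2)) y) =
        fun y => (-2 * u1) * Dw (-1, 0) (fun y => (f22 y - f11 y) / 2) y := by
    funext y
    have : ((-u1, u1) : ℝ × ℝ) - (u1, u1) = (2 * u1) • (-1, 0) := by
      ext <;> simp [two_mul, sub_eq_add_neg]
    rw [Dw_fun_neg, neg_neg]
    simp only [Dw]
    rw [neg_add_eq_sub, ← neg_sub, ← map_sub, this, map_smul, smul_eq_mul]
    ring
  rw [hLT, hM, Dw_Dw_Xray_add_Xray (m := m) (l := m) hsum hsum csum csum hmu hmv hmu.le hmv.le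
      (by simp [m]),
    Dw_Dw_Xray_add_Xray (m := m) (l := l) hdif hdif' cdif cdif' hmu hmv (by simp [l])
      (by simp [l]; linarith) (by simp [l]),
    hDsum, hDdif, Xray_const_mul, Xray_const_mul,
    Xray_Dw_self (l := m) (hsum.of_le one_le_two) (.of_hasCompactSupport csum) (by simp [m]),
    Xray_Dw_self (l := l) (hdif.of_le one_le_two) (.of_hasCompactSupport cdif) (by simp [l])]
  field_simp
  ring
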